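/- For every finite connected simple port-labeled graph G with n vertices, every root vertex v_R, and every integer k with 1 ≤ k ≤ n, the k-stopped port-DFS traversal of G from v_R halts after finitely many moves, and the set V' of the k vertices it has visited induces a connected subgraph G[V'] of G. -/

import Mathlib

open scoped Classical

/-- Direction of a move of the port-DFS traversal. -/
inductive PDir : Type where
  | fwd : PDir
  | bwd : PDir
deriving DecidableEq

/-- Position of the port-DFS walk: before the first move (`start`, at the root),
having just arrived at `cur` via in-port `inPort` with direction `dir` (`moving`),
or halted at a vertex. -/
inductive PPos (V : Type) : Type where
  | start : PPos V
  | moving : V → ℕ → PDir → PPos V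
  | halted : V → PPos V

/-- Full state of the port-DFS traversal: position, set `S` of visited vertices,
and parent-port assignment `par`. -/
structure PState (V : Type) : Type where
  pos : PPos V
  vis : Finset V
  par : V → ℕ

/-- A finite connected simple port-labeled graph: for every vertex `u` of degree
`deg u`, the edges incident to `u` are labeled by distinct ports `0, …, deg u - 1`;
`port u v` is the port at `u` of the edge `{u, v}`. -/
structure PortedGraph (V : Type) [Fintype V] [DecidableEq V] : Type where
  G : SimpleGraph V
  conn : G.Connected
  deg : V → ℕ
  port : V → V → ℕ
  port_lt : ∀ {u v : V}, G.Adj u v → port u v < deg u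
  port_inj : ∀ {u v w : V}, G.Adj u v → G.Adj u w → port u v = port u w → v = w
  port_surj : ∀ {u : V} (p : ℕ), p < deg u → ∃ v : V, G.Adj u v ∧ port u v = p

namespace PortedGraph

variable {V : Type} [Fintype V] [DecidableEq V]

/-- The neighbor of `u` reached from `u` through port `p`. -/
noncomputable def dest (P : PortedGraph V) (u : V) (p : ℕ) : V :=
  if h : ∃ v : V, P.G.Adj u v ∧ P.port u v = p then h.choose else u

/-- One step of the port-DFS traversal from root `vR`.  A state with
`pos = moving v q d` means the walk has just arrived at `v` via port `q` (at `v`)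
with direction `d`, and `vis`/`par` are the data from before processing this
arrival; the step processes the arrival according to rules (i)–(v) and performs
the next move (or halts). -/
noncomputable def step (P : PortedGraph V) (vR : V) (s : PState V) : PState V :=
  match s.pos with
  | PPos.start =>
      if 0 < P.deg vR then
        { pos := PPos.moving (P.dest vR 0) (P.port (P.dest vR 0) vR) PDir.fwd,
          vis := s.vis, par := s.par }
      else
        { pos := PPos.halted vR, vis := s.vis, par := s.par }
  | PPos.halted v => { pos := PPos.halted v, vis := s.vis, par := s.par }
  | PPos.moving v q PDir.fwd =>
      if v ∈ s.vis then
        -- rule (ii): leave via `q` with direction backward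
        { pos := PPos.moving (P.dest v q) (P.port (P.dest v q) v) PDir.bwd,
          vis := s.vis, par := s.par }
      else
        -- rule (i): add `v` to `S`, set `par v := q`, leave via `(q+1) % deg v`
        { pos := PPos.moving (P.dest v ((q + 1) % P.deg v))
            (P.port (P.dest v ((q + 1) % P.deg v)) v)
            (if (q + 1) % P.deg v = q then PDir.bwd else PDir.fwd),
          vis := insert v s.vis, par := Function.update s.par v q }
  | PPos.moving v q PDir.bwd =>
      if v ≠ vR ∧ (q + 1) % P.deg v = s.par v then
        -- rule (iii): leave via the parent port with direction backward
        { pos := PPos.moving (P.dest v (s.par v)) (P.port (P.dest v (s.par v)) v) PDir.bwd,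
          vis := s.vis, par := s.par }
      else if v = vR ∧ (q + 1) % P.deg v = 0 then
        -- rule (iv): halt
        { pos := PPos.halted v, vis := s.vis, par := s.par }
      else
        -- rule (v): leave via `(q+1) % deg v` with direction forward
        { pos := PPos.moving (P.dest v ((q + 1) % P.deg v))
            (P.port (P.dest v ((q + 1) % P.deg v)) v) PDir.fwd,
          vis := s.vis, par := s.par }

/-- The trace of the port-DFS traversal from `vR`:  `trace P vR t` is the state
after `t` transitions; every transition except those into/out of a halted
position is a move along an edge. -/
noncomputable def trace (P : PortedGraph V) (vR : V) : ℕ → PState V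
  | 0 => { pos := PPos.start, vis := {vR}, par := fun _ => 0 }
  | t + 1 => P.step vR (P.trace vR t)

/-- The first time at which `k` distinct vertices have been visited; the
`k`-stopped traversal is the traversal halted at that moment (at which point the
walk, having made `stopTime - 1` moves, stands at the `k`-th visited vertex). -/
noncomputable def stopTime (P : PortedGraph V) (vR : V) (k : ℕ) : ℕ :=
  sInf {t : ℕ | k ≤ ((P.trace vR t).vis).card}

/-- `V'`: the set of vertices visited by the `k`-stopped traversal. -/
noncomputable def visitedBy (P : PortedGraph V) (vR : V) (k : ℕ) : Finset V :=
  (P.trace vR (P.stopTime vR k)).vis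

/-- `V'` as a set. -/
noncomputable def Vset (P : PortedGraph V) (vR : V) (k : ℕ) : Set V :=
  ↑(P.visitedBy vR k)

/-- The parent-port assignment at the end of the `k`-stopped traversal. -/
noncomputable def parFinal (P : PortedGraph V) (vR : V) (k : ℕ) : V → ℕ :=
  (P.trace vR (P.stopTime vR k)).par

/-- `u(v)`: the neighbor of `v` reached from `v` through its parent port. -/
noncomputable def parentVert (P : PortedGraph V) (vR : V) (k : ℕ) (v : V) : V :=
  P.dest v (P.parFinal vR k v)

/-- `v_L`: the `k`-th (last) vertex added to `S` by the `k`-stopped traversal. -/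
noncomputable def lastVert (P : PortedGraph V) (vR : V) (k : ℕ) : V :=
  if h : ∃ v : V, v ∈ P.visitedBy vR k ∧ v ∉ (P.trace vR (P.stopTime vR k - 1)).vis
  then h.choose else vR

/-- The tree `T` of parent edges `{v, u(v)}`, `v ∈ V' \ {v_R}`, as a graph on `V`
(vertices outside `V'` are isolated). -/
noncomputable def treeRel (P : PortedGraph V) (vR : V) (k : ℕ) : SimpleGraph V :=
  SimpleGraph.fromRel (fun a b =>
    a ∈ P.visitedBy vR k ∧ a ≠ vR ∧ b = P.parentVert vR k a)

/-- The tree `T` of parent edges as a graph on the vertex set `V'`. -/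
noncomputable def treeSub (P : PortedGraph V) (vR : V) (k : ℕ) :
    SimpleGraph (P.Vset vR k) :=
  SimpleGraph.fromRel (fun a b => (a : V) ≠ vR ∧ (b : V) = P.parentVert vR k (a : V))

/-- `v` lies on the rootpath: the unique path in `T` from `v_R` to `v_L`. -/
def onRootpath (P : PortedGraph V) (vR : V) (k : ℕ) (v : V) : Prop :=
  ∃ p : (P.treeRel vR k).Walk vR (P.lastVert vR k), p.IsPath ∧ v ∈ p.support

/-- The move made out of state `s`:  `some (v, p, d)` if the walk leaves vertex
`v` via port `p` with direction `d`, and `none` if it halts (or already halted). -/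
noncomputable def exitEvent (P : PortedGraph V) (vR : V) (s : PState V) :
    Option (V × ℕ × PDir) :=
  match s.pos with
  | PPos.start => if 0 < P.deg vR then some (vR, 0, PDir.fwd) else none
  | PPos.halted _ => none
  | PPos.moving v q PDir.fwd =>
      if v ∈ s.vis then some (v, q, PDir.bwd)
      else some (v, (q + 1) % P.deg v,
        if (q + 1) % P.deg v = q then PDir.bwd else PDir.fwd)
  | PPos.moving v q PDir.bwd =>
      if v ≠ vR ∧ (q + 1) % P.deg v = s.par v then some (v, s.par v, PDir.bwd)
      else if v = vR ∧ (q + 1) % P.deg v = 0 then none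
      else some (v, (q + 1) % P.deg v, PDir.fwd)

end PortedGraph

namespace PortedGraph

section Traversal

variable {V : Type} [Fintype V] [DecidableEq V] {P : PortedGraph V} {vR w x : V}
  {vis : Finset V} {par c r : V → ℕ}

theorem dest_port {u v : V} (h : P.G.Adj u v) : P.dest u (P.port u v) = v := by
  have hex : ∃ y : V, P.G.Adj u y ∧ P.port u y = P.port u v := ⟨v, h, rfl⟩
  rw [dest, dif_pos hex]
  exact P.port_inj hex.choose_spec.1 h hex.choose_spec.2

theorem adj_dest {u : V} {p : ℕ} (h : p < P.deg u) : P.G.Adj u (P.dest u p) := by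
  obtain ⟨v, hv, rfl⟩ := P.port_surj p h
  rwa [dest_port hv]

theorem port_dest {u : V} {p : ℕ} (h : p < P.deg u) : P.port u (P.dest u p) = p := by
  obtain ⟨v, hv, rfl⟩ := P.port_surj p h
  rw [dest_port hv]

/-- A set of vertices containing the root and closed under adjacency is everything. -/
theorem eq_univ_of_closed (hroot : vR ∈ vis)
    (hclosed : ∀ u ∈ vis, ∀ v, P.G.Adj u v → v ∈ vis) : vis = Finset.univ := by
  refine Finset.eq_univ_iff_forall.2 fun y => ?_
  obtain ⟨p⟩ := P.conn.preconnected vR y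
  induction p with
  | nil => exact hroot
  | cons h _ ih => exact ih (hclosed _ hroot _ h)

/-- The `i`-th port in the order in which the traversal uses the ports of `v`: a non-root
vertex starts after its parent port, the root starts with port `0` (at `i = 1`). -/
noncomputable def portSeq (P : PortedGraph V) (vR : V) (par : V → ℕ) (v : V) (i : ℕ) : ℕ :=
  ((if v = vR then P.deg v - 1 else par v) + i) % P.deg v

theorem portSeq_succ (v : V) (i : ℕ) :
    (P.portSeq vR par v i + 1) % P.deg v = P.portSeq vR par v (i + 1) := by
  simp only [portSeq, Nat.mod_add_mod, Nat.add_assoc]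

theorem portSeq_congr {par' : V → ℕ} {v : V} (h : par' v = par v) (i : ℕ) :
    P.portSeq vR par' v i = P.portSeq vR par v i := by
  simp only [portSeq, h]

theorem portSeq_lt {v : V} {i : ℕ} (h : 0 < P.deg v) : P.portSeq vR par v i < P.deg v :=
  Nat.mod_lt _ h

theorem portSeq_zero {v : V} (hv : v ≠ vR) (hpar : par v < P.deg v) :
    P.portSeq vR par v 0 = par v := by
  rw [portSeq, if_neg hv, Nat.add_zero, Nat.mod_eq_of_lt hpar]

theorem portSeq_eq_par_iff {v : V} {i : ℕ} (hv : v ≠ vR) (hpar : par v < P.deg v)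
    (hi : 0 < i) (hi' : i ≤ P.deg v) : P.portSeq vR par v i = par v ↔ i = P.deg v := by
  rw [portSeq, if_neg hv]
  rcases lt_or_ge (par v + i) (P.deg v) with h | h
  · rw [Nat.mod_eq_of_lt h]; omega
  · rw [Nat.mod_eq_sub_mod h, Nat.mod_eq_of_lt (by omega)]; omega

theorem portSeq_root_eq_zero_iff {i : ℕ} (hi : 0 < i) (hi' : i ≤ P.deg vR) :
    P.portSeq vR par vR (i + 1) = 0 ↔ i = P.deg vR := by
  rw [portSeq, if_pos rfl, show P.deg vR - 1 + (i + 1) = P.deg vR + i by omega,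
    Nat.add_mod_left]
  rcases hi'.lt_or_eq with h | h
  · rw [Nat.mod_eq_of_lt h]; omega
  · simp [h]

theorem exists_portSeq_eq {v : V} {p : ℕ} (hpar : v ≠ vR → par v < P.deg v)
    (hp : p < P.deg v) : ∃ i, 0 < i ∧ i ≤ P.deg v ∧ P.portSeq vR par v i = p := by
  obtain ⟨b, hb, hbdef⟩ : ∃ b, b < P.deg v ∧ (if v = vR then P.deg v - 1 else par v) = b := by
    refine ⟨_, ?_, rfl⟩
    split_ifs with h
    · omega
    · exact hpar h
  rcases lt_or_ge b p with h | h
  · refine ⟨p - b, by omega, by omega, ?_⟩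
    rw [portSeq, hbdef, show b + (p - b) = p by omega, Nat.mod_eq_of_lt hp]
  · refine ⟨p + P.deg v - b, by omega, by omega, ?_⟩
    rw [portSeq, hbdef, show b + (p + P.deg v - b) = p + P.deg v by omega, Nat.add_mod_right,
      Nat.mod_eq_of_lt hp]

/-- Bookkeeping invariant of the traversal.  `c u` counts the ports through which `u` has
been left, `r` is a rank that decreases towards the root along parent edges, `w` is the
vertex on top of the search stack and `x` the vertex at which the walk stands.  The visited
non-root vertices `u` with `c u < deg u` are the unfinished ones. -/
structure SearchInv (P : PortedGraph V) (vR : V) (vis : Finset V) (par c r : V → ℕ)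
    (w x : V) : Prop where
  root_mem : vR ∈ vis
  top_mem : w ∈ vis
  count_le : ∀ u, c u ≤ P.deg u
  count_root : 0 < c vR
  count_eq_zero : ∀ u, u ∉ vis → c u = 0
  top_lt : w ≠ vR → c w < P.deg w
  parent : ∀ u ∈ vis, u ≠ vR → ∃ p ∈ vis, P.G.Adj u p ∧ P.port u p = par u ∧ r p < r u ∧
    (c u < P.deg u → p ≠ w ∧ P.portSeq vR par p (c p) = P.port p u ∧
      (p ≠ vR → c p < P.deg p))
  seen : ∀ u ∈ vis, ∀ i, 0 < i → i ≤ c u →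
    P.dest u (P.portSeq vR par u i) ∈ vis ∨ P.dest u (P.portSeq vR par u i) = x

namespace SearchInv

theorem par_lt (h : P.SearchInv vR vis par c r w x) {u : V} (hu : u ∈ vis) (hne : u ≠ vR) :
    par u < P.deg u := by
  obtain ⟨p, -, hadj, hpar, -⟩ := h.parent u hu hne
  exact hpar ▸ P.port_lt hadj

theorem top_deg_pos (h : P.SearchInv vR vis par c r w x) : 0 < P.deg w := by
  by_cases hw : w = vR
  · subst hw; exact h.count_root.trans_le (h.count_le _)
  · exact (Nat.zero_le _).trans_lt (h.top_lt hw)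

/-- The walk leaves the top vertex forward through its next port. -/
theorem advance (h : P.SearchInv vR vis par c r w x) (hx : x ∈ vis)
    (hc : c w + 1 ≤ P.deg w) (hlt : w ≠ vR → c w + 1 < P.deg w) :
    P.SearchInv vR vis par (fun u => if u = w then c u + 1 else c u) r w
      (P.dest w (P.portSeq vR par w (c w + 1))) where
  root_mem := h.root_mem
  top_mem := h.top_mem
  count_le u := by
    have := h.count_le u
    grind
  count_root := by
    have := h.count_root
    grind
  count_eq_zero u hu := by
    have := h.count_eq_zero u hu
    have := h.top_mem
    grind
  top_lt hw := by simpa using hlt hw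
  parent u hu hne := by
    obtain ⟨p, hp, hadj, hpar, hr, himp⟩ := h.parent u hu hne
    refine ⟨p, hp, hadj, hpar, hr, fun hu' => ?_⟩
    obtain ⟨hpw, hport, hcp⟩ := himp (by grind)
    exact ⟨hpw, by simpa [hpw] using hport, by simpa [hpw] using hcp⟩
  seen u hu i hi hiu := by
    by_cases hiu' : i ≤ c u
    · rcases h.seen u hu i hi hiu' with h' | h'
      · exact Or.inl h'
      · exact Or.inl (h' ▸ hx)
    · right
      have huw : u = w := by grind
      subst huw
      have hi' : i = c u + 1 := by grind
      rw [hi']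

/-- The walk leaves a non-root top vertex backward through its parent port. -/
theorem finish (h : P.SearchInv vR vis par c r w x) (hx : x ∈ vis) (hw : w ≠ vR)
    (hc : c w + 1 = P.deg w) :
    ∃ p, P.dest w (par w) = p ∧ P.port p w = P.portSeq vR par p
        (if p = w then c p + 1 else c p) ∧
      P.SearchInv vR vis par (fun u => if u = w then c u + 1 else c u) r p p := by
  obtain ⟨p, hp, hadj, hpar, -, himp⟩ := h.parent w h.top_mem hw
  obtain ⟨hpw, hport, hcp⟩ := himp (by omega)
  have hdest : P.dest w (par w) = p := by rw [← hpar, dest_port hadj]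
  refine ⟨p, hdest, by simp [hpw, hport], ?_⟩
  exact {
    root_mem := h.root_mem
    top_mem := hp
    count_le := fun u => by
      have := h.count_le u
      grind
    count_root := by
      have := h.count_root
      grind
    count_eq_zero := fun u hu => by
      have := h.count_eq_zero u hu
      have := h.top_mem
      grind
    top_lt := fun hpR => by simpa [hpw] using hcp hpR
    parent := fun u hu hne => by
      obtain ⟨y, hy, hadj', hpar', hr, himp'⟩ := h.parent u hu hne
      refine ⟨y, hy, hadj', hpar', hr, fun hu' => ?_⟩
      have huw : u ≠ w := by
        rintro rfl
        simp [hc] at hu'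
      obtain ⟨hyw, hport', hcy⟩ := himp' (by simpa [huw] using hu')
      refine ⟨?_, by simpa [hyw] using hport', by simpa [hyw] using hcy⟩
      rintro rfl
      exact huw (P.port_inj hadj'.symm hadj.symm (hport'.symm.trans hport))
    seen := fun u hu i hi hiu => by
      left
      by_cases hiu' : i ≤ c u
      · rcases h.seen u hu i hi hiu' with h' | h'
        · exact h'
        · exact h' ▸ hx
      · have huw : u = w := by grind
        subst huw
        have hi' : i = P.deg u := by grind
        rw [(portSeq_eq_par_iff hw (h.par_lt hu hw) hi hi'.le).2 hi', hdest]
        exact hp }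

/-- The walk enters an unvisited vertex. -/
theorem push (h : P.SearchInv vR vis par c r w x) (hx : x ∉ vis) (hadj : P.G.Adj w x)
    (hport : P.port w x = P.portSeq vR par w (c w)) :
    P.SearchInv vR (insert x vis) (Function.update par x (P.port x w)) c
      (Function.update r x (r w + 1)) x x where
  root_mem := Finset.mem_insert_of_mem h.root_mem
  top_mem := Finset.mem_insert_self _ _
  count_le := h.count_le
  count_root := h.count_root
  count_eq_zero u hu := h.count_eq_zero u fun hu' => hu (Finset.mem_insert_of_mem hu')
  top_lt _ := by
    rw [h.count_eq_zero x hx]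
    exact (Nat.zero_le _).trans_lt (P.port_lt hadj.symm)
  parent u hu hne := by
    rcases Finset.mem_insert.1 hu with rfl | hu
    · have hwx : w ≠ u := hadj.ne
      refine ⟨w, Finset.mem_insert_of_mem h.top_mem, hadj.symm, by simp, by simp [hwx],
        fun _ => ⟨hwx, ?_, h.top_lt⟩⟩
      rw [portSeq_congr (Function.update_of_ne hwx _ _), hport]
    · obtain ⟨p, hp, hadj', hpar, hr, himp⟩ := h.parent u hu hne
      have hux : u ≠ x := fun e => hx (e ▸ hu)
      have hpx : p ≠ x := fun e => hx (e ▸ hp)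
      refine ⟨p, Finset.mem_insert_of_mem hp, hadj', by simpa [hux] using hpar,
        by simpa [hux, hpx] using hr, fun hu' => ⟨hpx, ?_, (himp hu').2.2⟩⟩
      rw [portSeq_congr (Function.update_of_ne hpx _ _), (himp hu').2.1]
  seen u hu i hi hiu := by
    left
    rcases Finset.mem_insert.1 hu with rfl | hu
    · rw [h.count_eq_zero u hx] at hiu
      omega
    · have hux : u ≠ x := fun e => hx (e ▸ hu)
      rw [portSeq_congr (Function.update_of_ne hux _ _), Finset.mem_insert]
      exact (h.seen u hu i hi hiu).symm

/-- If the root is on top and has used all its ports, every vertex has been visited. -/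
theorem eq_univ (h : P.SearchInv vR vis par c r vR x) (hx : x ∈ vis)
    (hc : c vR = P.deg vR) : vis = Finset.univ := by
  have hdone : ∀ n, ∀ u ∈ vis, r u = n → c u = P.deg u := by
    intro n
    induction n using Nat.strong_induction_on with
    | _ n ih =>
      intro u hu hn
      by_cases hne : u = vR
      · rw [hne, hc]
      · obtain ⟨p, hp, -, -, hr, himp⟩ := h.parent u hu hne
        by_contra hcu
        obtain ⟨hpw, -, hcp⟩ := himp (lt_of_le_of_ne (h.count_le u) hcu)
        exact (hcp hpw).ne (ih (r p) (hn ▸ hr) p hp rfl)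
  refine eq_univ_of_closed (P := P) h.root_mem fun u hu v hadj => ?_
  obtain ⟨i, hi, hi', hp⟩ := exists_portSeq_eq (vR := vR) (par := par)
    (fun hne => h.par_lt hu hne) (P.port_lt hadj)
  have := h.seen u hu i hi (by rwa [hdone _ u hu rfl])
  rw [hp, dest_port hadj] at this
  rcases this with h' | rfl
  · exact h'
  · exact hx

theorem connected (h : P.SearchInv vR vis par c r w x) :
    (P.G.induce (vis : Set V)).Connected := by
  have hreach : ∀ n, ∀ u (hu : u ∈ vis), r u = n →
      (P.G.induce (vis : Set V)).Reachable ⟨vR, h.root_mem⟩ ⟨u, hu⟩ := by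
    intro n
    induction n using Nat.strong_induction_on with
    | _ n ih =>
      intro u hu hn
      by_cases hne : u = vR
      · subst hne
        exact SimpleGraph.Reachable.refl _
      · obtain ⟨p, hp, hadj, -, hr, -⟩ := h.parent u hu hne
        refine (ih (r p) (hn ▸ hr) p hp rfl).trans (SimpleGraph.Adj.reachable ?_)
        exact hadj.symm
  refine (SimpleGraph.connected_iff _).2 ⟨fun a b => ?_, ⟨⟨vR, h.root_mem⟩⟩⟩
  exact (hreach _ a.1 a.2 rfl).symm.trans (hreach _ b.1 b.2 rfl)

theorem sum_le (h : P.SearchInv vR vis par c r w x) : ∑ u, c u ≤ ∑ u, P.deg u :=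
  Finset.sum_le_sum fun u _ => h.count_le u

end SearchInv

theorem sum_increment (c : V → ℕ) (w : V) :
    ∑ u, (if u = w then c u + 1 else c u) = ∑ u, c u + 1 := by
  have : ∀ u, (if u = w then c u + 1 else c u) = c u + if u = w then 1 else 0 := by
    intro u
    split_ifs <;> rfl
  simp [this, Finset.sum_add_distrib]

/-- What holds of the state of the traversal after `t` transitions. -/
def StateInv (P : PortedGraph V) (vR : V) (t : ℕ) (s : PState V) : Prop :=
  match s.pos with
  | PPos.start => s.vis = {vR} ∧ t = 0
  | PPos.halted _ => s.vis = Finset.univ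
  | PPos.moving v q PDir.fwd => ∃ c r w, P.SearchInv vR s.vis s.par c r w v ∧ P.G.Adj w v ∧
      q = P.port v w ∧ P.port w v = P.portSeq vR s.par w (c w) ∧ t ≤ 2 * ∑ u, c u
  | PPos.moving v q PDir.bwd => ∃ c r, P.SearchInv vR s.vis s.par c r v v ∧
      q = P.portSeq vR s.par v (c v) ∧ t ≤ 2 * (∑ u, c u) + 1

theorem SearchInv.stateInv_advance {v : V} {t : ℕ} (h : P.SearchInv vR vis par c r v v)
    (hc : c v + 1 ≤ P.deg v) (hlt : v ≠ vR → c v + 1 < P.deg v)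
    (ht : t ≤ 2 * (∑ u, c u) + 1) :
    P.StateInv vR (t + 1)
      { pos := PPos.moving (P.dest v (P.portSeq vR par v (c v + 1)))
          (P.port (P.dest v (P.portSeq vR par v (c v + 1))) v) PDir.fwd,
        vis := vis, par := par } := by
  refine ⟨_, r, v, h.advance h.top_mem hc hlt, adj_dest (portSeq_lt h.top_deg_pos), rfl, ?_, ?_⟩
  · rw [port_dest (portSeq_lt h.top_deg_pos), if_pos rfl]
  · rw [sum_increment]
    omega

theorem SearchInv.stateInv_finish {v : V} {t : ℕ} (h : P.SearchInv vR vis par c r v v)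
    (hv : v ≠ vR) (hc : c v + 1 = P.deg v) (ht : t ≤ 2 * (∑ u, c u) + 1) :
    P.StateInv vR (t + 1)
      { pos := PPos.moving (P.dest v (par v)) (P.port (P.dest v (par v)) v) PDir.bwd,
        vis := vis, par := par } := by
  obtain ⟨p, rfl, hport, hp⟩ := h.finish h.top_mem hv hc
  refine ⟨_, r, hp, hport, ?_⟩
  rw [sum_increment]
  omega

theorem StateInv.step {t : ℕ} {s : PState V} (h : P.StateInv vR t s) :
    P.StateInv vR (t + 1) (P.step vR s) := by
  obtain ⟨pos, vis, par⟩ := s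
  rcases pos with _ | ⟨v, q, _ | _⟩ | v
  · obtain ⟨rfl, rfl⟩ := h
    simp only [PortedGraph.step]
    split_ifs with hdeg
    · have hseq : P.portSeq vR par vR 1 = 0 := by
        rw [portSeq, if_pos rfl, show P.deg vR - 1 + 1 = P.deg vR by omega, Nat.mod_self]
      refine ⟨fun u => if u = vR then 1 else 0, fun _ => 0, vR, ?_, adj_dest hdeg, rfl, ?_, ?_⟩
      · exact {
          root_mem := by simp
          top_mem := by simp
          count_le := fun u => by grind
          count_root := by simp
          count_eq_zero := fun u hu => by simpa using hu
          top_lt := fun hne => absurd rfl hne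
          parent := fun u hu hne => absurd (by simpa using hu) hne
          seen := fun u hu i hi hiu => by
            obtain rfl : u = vR := by simpa using hu
            obtain rfl : i = 1 := by grind
            exact Or.inr (by rw [hseq]) }
      · simp [port_dest hdeg, hseq]
      · simp
    · refine eq_univ_of_closed (P := P) (Finset.mem_singleton_self vR) fun u hu v hadj => ?_
      obtain rfl : u = vR := by simpa using hu
      exact absurd ((Nat.zero_le _).trans_lt (P.port_lt hadj)) hdeg
  · obtain ⟨c, r, w, hinv, hadj, rfl, hport, ht⟩ := h
    dsimp only at hinv hport
    simp only [PortedGraph.step]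
    by_cases hv : v ∈ vis
    · rw [if_pos hv, dest_port hadj.symm]
      refine ⟨c, r, { hinv with seen := fun u hu i hi hiu => ?_ }, hport, by omega⟩
      rcases hinv.seen u hu i hi hiu with h' | h'
      · exact Or.inl h'
      · exact Or.inl (h' ▸ hv)
    · rw [if_neg hv]
      have hne : v ≠ vR := fun e => hv (e ▸ hinv.root_mem)
      have hcv : c v = 0 := hinv.count_eq_zero v hv
      have hpush := hinv.push hv hadj hport
      have hlt := hpush.par_lt (Finset.mem_insert_self v vis) hne
      have hseq := portSeq_zero hne hlt
      have hpar : Function.update par v (P.port v w) v = P.port v w := Function.update_self ..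
      have hsucc := portSeq_succ (P := P) (vR := vR)
        (par := Function.update par v (P.port v w)) v 0
      rw [hseq, hpar] at hsucc
      have hiff := portSeq_eq_par_iff hne hlt one_pos hpush.top_deg_pos
      rw [hpar] at hiff
      rw [hsucc, Nat.zero_add]
      by_cases hdeg : 1 = P.deg v
      · have := hpush.stateInv_finish hne (by omega) (t := t) (by omega)
        rw [hpar] at this
        rwa [if_pos (hiff.2 hdeg), hiff.2 hdeg]
      · have hpos := hpush.top_deg_pos
        have := hpush.stateInv_advance (by omega) (fun _ => by omega) (t := t) (by omega)
        rw [hcv, Nat.zero_add] at this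
        rwa [if_neg (mt hiff.1 hdeg)]
  · obtain ⟨c, r, hinv, hq, ht⟩ := h
    dsimp only at hinv hq
    subst hq
    simp only [PortedGraph.step, portSeq_succ]
    by_cases hv : v = vR
    · subst hv
      have hiff := portSeq_root_eq_zero_iff (par := par) hinv.count_root (hinv.count_le v)
      simp only [ne_eq, not_true_eq_false, false_and, if_false, true_and]
      split_ifs with h0
      · exact hinv.eq_univ hinv.top_mem (hiff.1 h0)
      · have := hinv.count_le v
        have := mt hiff.2 h0
        exact hinv.stateInv_advance (by omega) (fun h => absurd rfl h) ht
    · have hlt := hinv.top_lt hv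
      have hiff := portSeq_eq_par_iff hv (hinv.par_lt hinv.top_mem hv) (Nat.succ_pos (c v)) hlt
      simp only [hv, ne_eq, not_false_eq_true, true_and, false_and, if_false]
      split_ifs with h0
      · exact hinv.stateInv_finish hv (hiff.1 h0) ht
      · have := mt hiff.2 h0
        exact hinv.stateInv_advance hlt (fun _ => by omega) ht
  · exact h

theorem stateInv_trace (P : PortedGraph V) (vR : V) (t : ℕ) :
    P.StateInv vR t (P.trace vR t) := by
  induction t with
  | zero => exact ⟨rfl, rfl⟩
  | succ t ih => exact ih.step

theorem StateInv.connected {t : ℕ} {s : PState V} (h : P.StateInv vR t s) :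
    (P.G.induce (s.vis : Set V)).Connected := by
  obtain ⟨pos, vis, par⟩ := s
  rcases pos with _ | ⟨v, q, _ | _⟩ | v
  · obtain ⟨rfl, -⟩ := h
    have : Subsingleton (({vR} : Finset V) : Set V) := by
      rw [Finset.coe_singleton]
      infer_instance
    exact (SimpleGraph.connected_iff _).2
      ⟨SimpleGraph.Preconnected.of_subsingleton, ⟨⟨vR, by simp⟩⟩⟩
  · obtain ⟨c, r, w, hinv, -⟩ := h
    exact hinv.connected
  · obtain ⟨c, r, hinv, -⟩ := h
    exact hinv.connected
  · obtain rfl : vis = Finset.univ := h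
    rw [Finset.coe_univ]
    exact (SimpleGraph.induceUnivIso P.G).connected_iff.2 P.conn

theorem StateInv.eq_univ_of_lt {t : ℕ} {s : PState V} (h : P.StateInv vR t s)
    (ht : 2 * (∑ u, P.deg u) + 1 < t) : s.vis = Finset.univ := by
  obtain ⟨pos, vis, par⟩ := s
  rcases pos with _ | ⟨v, q, _ | _⟩ | v
  · obtain ⟨-, rfl⟩ := h
    omega
  · obtain ⟨c, r, w, hinv, -, -, -, hle⟩ := h
    have := hinv.sum_le
    omega
  · obtain ⟨c, r, hinv, -, hle⟩ := h
    have := hinv.sum_le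
    omega
  · exact h

theorem card_vis_step_le (P : PortedGraph V) (vR : V) (s : PState V) :
    (P.step vR s).vis.card ≤ s.vis.card + 1 := by
  obtain ⟨pos, vis, par⟩ := s
  rcases pos with _ | ⟨v, q, _ | _⟩ | v <;> simp only [PortedGraph.step] <;> try split_ifs
  all_goals
    first
    | exact Finset.card_insert_le _ _
    | exact Nat.le_succ _

/-- The traversal has visited exactly `k` vertices at its `k`-th stopping time. -/
theorem card_visitedBy (P : PortedGraph V) (vR : V) {k : ℕ} (hk1 : 1 ≤ k)
    (hk2 : k ≤ Fintype.card V) : (P.visitedBy vR k).card = k := by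
  have hne : {t : ℕ | k ≤ (P.trace vR t).vis.card}.Nonempty := by
    refine ⟨2 * (∑ u, P.deg u) + 2, ?_⟩
    rw [Set.mem_ofPred_eq, (P.stateInv_trace vR _).eq_univ_of_lt (by omega)]
    exact hk2
  refine le_antisymm ?_ (Nat.sInf_mem hne)
  rw [visitedBy]
  rcases ht : P.stopTime vR k with _ | t
  · exact hk1
  · have hlt : t < sInf {t : ℕ | k ≤ (P.trace vR t).vis.card} :=
      (Nat.lt_succ_self t).trans_eq ht.symm
    have hcard : (P.trace vR t).vis.card < k := not_le.1 fun hle => Nat.notMem_of_lt_sInf hlt hle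
    exact (P.card_vis_step_le vR _).trans hcard

end Traversal

end PortedGraph

/-- For every finite connected simple port-labeled graph `G` with `n`
vertices, every root vertex `v_R`, and every `1 ≤ k ≤ n`, the `k`-stopped
port-DFS traversal halts after finitely many moves (some state has `k` visited
vertices), and the set `V'` of the `k` vertices it has visited induces a
connected subgraph `G[V']` of `G`. -/
theorem statement1 {V : Type} [Fintype V] [DecidableEq V]
    (P : PortedGraph V) (vR : V) (k : ℕ)
    (hk1 : 1 ≤ k) (hk2 : k ≤ Fintype.card V) :
    (∃ t : ℕ, ((P.trace vR t).vis).card = k) ∧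
    (P.visitedBy vR k).card = k ∧
    (P.G.induce (P.Vset vR k)).Connected := by
  have hcard := P.card_visitedBy vR hk1 hk2
  exact ⟨⟨P.stopTime vR k, hcard⟩, hcard, (P.stateInv_trace vR _).connected⟩
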